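/- Let n ≥ 1, let γ ∈ ℝ with γ ≠ 1, let μ : ℝⁿ → ℝ be smooth with μ(x) > 0 for all x, and let Φ : ℝⁿ → ℝ be smooth with compact support. Then ∫_{ℝⁿ} μ(x)^{−1} ( ∇·(μ^γ ∇Φ)(x) )² dx = ∫_{ℝⁿ} μ(x)^γ { −Δ(μ^{γ−1})(x)·‖∇Φ(x)‖² − (1/(γ−1))·Hess(μ^{γ−1})(x)(∇Φ(x), ∇Φ(x)) + μ(x)^{γ−1}·‖Hess Φ(x)‖² + γ(γ−1)·μ(x)^{γ−1}·( ⟨∇log μ(x), ∇Φ(x)⟩² − ‖∇log μ(x)‖²·‖∇Φ(x)‖² ) } dx. -/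

import Mathlib

open MeasureTheory Filter Set
open scoped InnerProductSpace Topology

/-- Partial derivative `∂ⱼ f x` on Euclidean space. -/
noncomputable def pder (n : ℕ) (j : Fin n) (f : EuclideanSpace ℝ (Fin n) → ℝ)
    (x : EuclideanSpace ℝ (Fin n)) : ℝ :=
  fderiv ℝ f x (EuclideanSpace.single j 1)

/-- Divergence `∇·v` of a vector field on Euclidean space. -/
noncomputable def divg (n : ℕ) (v : EuclideanSpace ℝ (Fin n) → EuclideanSpace ℝ (Fin n))
    (x : EuclideanSpace ℝ (Fin n)) : ℝ :=
  ∑ j, pder n j (fun y => v y j) x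

/-- Laplacian `Δf = ∑ⱼ ∂ⱼ∂ⱼ f`. -/
noncomputable def lapl (n : ℕ) (f : EuclideanSpace ℝ (Fin n) → ℝ)
    (x : EuclideanSpace ℝ (Fin n)) : ℝ :=
  ∑ j, pder n j (fun y => pder n j f y) x

/-- Entry `(i,j)` of the Hessian matrix of `f`. -/
noncomputable def hessij (n : ℕ) (f : EuclideanSpace ℝ (Fin n) → ℝ)
    (x : EuclideanSpace ℝ (Fin n)) (i j : Fin n) : ℝ :=
  pder n i (fun y => pder n j f y) x

/-- Hessian quadratic form `Hess f (u,u) = ∑ᵢⱼ (∂ᵢ∂ⱼf) uᵢ uⱼ`. -/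
noncomputable def hessQF (n : ℕ) (f : EuclideanSpace ℝ (Fin n) → ℝ)
    (x u : EuclideanSpace ℝ (Fin n)) : ℝ :=
  ∑ i, ∑ j, hessij n f x i j * u i * u j

/-- Squared Frobenius norm of the Hessian: `‖Hess f‖² = ∑ᵢⱼ (∂ᵢ∂ⱼf)²`. -/
noncomputable def hessFrob (n : ℕ) (f : EuclideanSpace ℝ (Fin n) → ℝ)
    (x : EuclideanSpace ℝ (Fin n)) : ℝ :=
  ∑ i, ∑ j, (hessij n f x i j)^2


section PartialDerivatives

variable {n : ℕ} {f g : EuclideanSpace ℝ (Fin n) → ℝ}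

theorem ContDiff.pder (hf : ContDiff ℝ (⊤ : ℕ∞) f) (i : Fin n) :
    ContDiff ℝ (⊤ : ℕ∞) (pder n i f) :=
  (hf.fderiv_right (m := (⊤ : ℕ∞)) (by norm_cast)).clm_apply contDiff_const

theorem ContDiff.pder_pder (hf : ContDiff ℝ (⊤ : ℕ∞) f) (i j : Fin n) :
    ContDiff ℝ (⊤ : ℕ∞) (_root_.pder n i (_root_.pder n j f)) :=
  (hf.pder j).pder i

theorem differentiableAt_of_smooth (hf : ContDiff ℝ (⊤ : ℕ∞) f)
    (x : EuclideanSpace ℝ (Fin n)) : DifferentiableAt ℝ f x :=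
  hf.differentiable (by simp) x

theorem pder_add (i : Fin n) (hf : ContDiff ℝ (⊤ : ℕ∞) f) (hg : ContDiff ℝ (⊤ : ℕ∞) g) :
    pder n i (fun y => f y + g y) = fun x => pder n i f x + pder n i g x := by
  ext x
  simp [pder, fderiv_fun_add (differentiableAt_of_smooth hf x) (differentiableAt_of_smooth hg x)]

theorem pder_sub (i : Fin n) (hf : ContDiff ℝ (⊤ : ℕ∞) f) (hg : ContDiff ℝ (⊤ : ℕ∞) g) :
    pder n i (fun y => f y - g y) = fun x => pder n i f x - pder n i g x := by
  ext x
  simp [pder, fderiv_fun_sub (differentiableAt_of_smooth hf x) (differentiableAt_of_smooth hg x)]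

theorem pder_mul (i : Fin n) (hf : ContDiff ℝ (⊤ : ℕ∞) f) (hg : ContDiff ℝ (⊤ : ℕ∞) g) :
    pder n i (fun y => f y * g y) = fun x => pder n i f x * g x + f x * pder n i g x := by
  ext x
  simp [pder, fderiv_fun_mul (differentiableAt_of_smooth hf x) (differentiableAt_of_smooth hg x)]
  ring

theorem pder_const_mul (i : Fin n) (c : ℝ) (hf : ContDiff ℝ (⊤ : ℕ∞) f) :
    pder n i (fun y => c * f y) = fun x => c * pder n i f x := by
  ext x
  simp [pder, fderiv_const_mul (differentiableAt_of_smooth hf x)]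

theorem pder_exp_const_mul (i : Fin n) (c : ℝ) (hf : ContDiff ℝ (⊤ : ℕ∞) f) :
    pder n i (fun y => Real.exp (c * f y)) =
      fun x => Real.exp (c * f x) * (c * pder n i f x) := by
  ext x
  have hd := (differentiableAt_of_smooth hf x).const_mul c
  simp [pder, fderiv_exp hd, fderiv_const_mul (differentiableAt_of_smooth hf x)]

theorem pder_comm (hf : ContDiff ℝ (⊤ : ℕ∞) f) (i j : Fin n) :
    pder n i (pder n j f) = pder n j (pder n i f) := by
  ext x
  have hd : DifferentiableAt ℝ (fderiv ℝ f) x :=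
    (hf.fderiv_right (m := (⊤ : ℕ∞)) (by norm_cast)).differentiable (by simp) x
  have key : ∀ k l : Fin n, pder n k (pder n l f) x =
      fderiv ℝ (fderiv ℝ f) x (EuclideanSpace.single k 1) (EuclideanSpace.single l 1) := by
    intro k l
    change fderiv ℝ (fun y => fderiv ℝ f y (EuclideanSpace.single l 1)) x _ = _
    rw [fderiv_clm_apply hd (by fun_prop)]
    simp
  rw [key, key]
  refine (hf.contDiffAt.isSymmSndFDerivAt ?_).eq _ _
  rw [minSmoothness_of_isRCLikeNormedField]
  norm_cast

theorem HasCompactSupport.pder (hf : HasCompactSupport f) (i : Fin n) :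
    HasCompactSupport (pder n i f) :=
  hf.fderiv_apply ℝ _

theorem pder_eq_zero_of_notMem_tsupport {x : EuclideanSpace ℝ (Fin n)} (hx : x ∉ tsupport f)
    (i : Fin n) : pder n i f x = 0 :=
  image_eq_zero_of_notMem_tsupport fun h => hx (tsupport_fderiv_apply_subset ℝ _ h)

theorem pder_pder_eq_zero_of_notMem_tsupport {x : EuclideanSpace ℝ (Fin n)}
    (hx : x ∉ tsupport f) (i j : Fin n) : pder n i (pder n j f) x = 0 :=
  pder_eq_zero_of_notMem_tsupport (fun h => hx (tsupport_fderiv_apply_subset ℝ _ h)) i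

theorem integrable_pder (hf : ContDiff ℝ (⊤ : ℕ∞) f) (hc : HasCompactSupport f) (i : Fin n) :
    Integrable (pder n i f) :=
  (hf.pder i).continuous.integrable_of_hasCompactSupport (hc.pder i)

theorem integral_pder_eq_zero (hf : ContDiff ℝ (⊤ : ℕ∞) f) (hc : HasCompactSupport f)
    (i : Fin n) : ∫ x, pder n i f x = 0 := by
  have h := integral_mul_fderiv_eq_neg_fderiv_mul_of_integrable (μ := volume)
    (f := fun _ : EuclideanSpace ℝ (Fin n) => (1 : ℝ)) (g := f) (v := EuclideanSpace.single i 1)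
    (by simp) (by simpa [pder] using! integrable_pder hf hc i)
    (by simpa using hf.continuous.integrable_of_hasCompactSupport hc)
    (by fun_prop) (fun x _ => differentiableAt_of_smooth hf x)
  simpa [pder] using h

theorem gradient_apply (f : EuclideanSpace ℝ (Fin n) → ℝ) (x : EuclideanSpace ℝ (Fin n))
    (i : Fin n) : gradient f x i = pder n i f x := by
  rw [pder, ← toDual_gradient, InnerProductSpace.toDual_apply_apply,
    EuclideanSpace.inner_single_right]
  simp

theorem norm_gradient_sq (f : EuclideanSpace ℝ (Fin n) → ℝ) (x : EuclideanSpace ℝ (Fin n)) :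
    ‖gradient f x‖ ^ 2 = ∑ i, pder n i f x ^ 2 := by
  simp [EuclideanSpace.real_norm_sq_eq, gradient_apply]

theorem inner_gradient (f g : EuclideanSpace ℝ (Fin n) → ℝ) (x : EuclideanSpace ℝ (Fin n)) :
    ⟪gradient f x, gradient g x⟫_ℝ = ∑ i, pder n i f x * pder n i g x := by
  simp only [PiLp.inner_apply, gradient_apply, RCLike.inner_apply, conj_trivial, mul_comm]

theorem hessij_exp_const_mul (c : ℝ) (hf : ContDiff ℝ (⊤ : ℕ∞) f)
    (x : EuclideanSpace ℝ (Fin n)) (i j : Fin n) :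
    hessij n (fun y => Real.exp (c * f y)) x i j =
      Real.exp (c * f x) *
        (c ^ 2 * (pder n i f x * pder n j f x) + c * pder n i (pder n j f) x) := by
  have := hf.pder j
  rw [hessij, pder_exp_const_mul j c hf, pder_mul i (by fun_prop) (by fun_prop),
    pder_exp_const_mul i c hf, pder_const_mul i c this]
  ring

end PartialDerivatives

section Yano

variable {n : ℕ}

/-- The terms of the pointwise generalized Bochner identity, as an identity between finite sums:
`P`, `P2`, `P3` stand for the derivatives of the potential and `w`, `w2` for those of the
logarithm of the weight. -/
theorem bochner_sum_identity (γ : ℝ) (hγ : γ ≠ 1) (P w : Fin n → ℝ)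
    (P2 w2 : Fin n → Fin n → ℝ) (P3 : Fin n → Fin n → Fin n → ℝ)
    (hP2 : ∀ i j, P2 i j = P2 j i) (hP3 : ∀ i j, P3 i i j = P3 j i i) :
    (∑ i, (P2 i i + γ * (w i * P i))) ^ 2 =
      (-(∑ i, ((γ - 1) ^ 2 * (w i * w i) + (γ - 1) * w2 i i)) * ∑ j, P j ^ 2
        - 1 / (γ - 1) * ∑ i, ∑ j, ((γ - 1) ^ 2 * (w i * w j) + (γ - 1) * w2 i j) * P i * P j
        + ∑ i, ∑ j, P2 i j ^ 2
        + γ * (γ - 1) * ((∑ i, w i * P i) ^ 2 - (∑ i, w i ^ 2) * ∑ j, P j ^ 2))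
      + ∑ i, ∑ j, ((2 * γ - 1) * w i *
            (P2 j j * P i - P2 i j * P j + w j * P j * P i + (γ - 1) * (w i * (P j * P j)))
          + (P3 i j j * P i + P2 j j * P2 i i - (P3 i i j * P j + P2 i j * P2 i j)
            + ((w2 i j * P j + w j * P2 i j) * P i + w j * P j * P2 i i)
            + (γ - 1) * (w2 i i * (P j * P j) + w i * (P2 i j * P j + P j * P2 i j)))) := by
  have hc : γ - 1 ≠ 0 := sub_ne_zero.mpr hγ
  have swap : ∑ i, ∑ j, (((γ - 1) * (w i * P i * P2 j j) + w j * P2 i j * P i + P3 i j j * P i)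
      - ((γ - 1) * (w j * P j * P2 i i) + w i * P2 j i * P j + P3 j i i * P j)) = 0 := by
    simp only [Finset.sum_sub_distrib]
    rw [sub_eq_zero, Finset.sum_comm]
  rw [← add_zero (_ ^ 2), ← swap]
  simp only [sq (∑ i, _), neg_mul, Finset.sum_mul_sum]
  simp only [Finset.mul_sum, ← Finset.sum_neg_distrib, ← Finset.sum_add_distrib,
    ← Finset.sum_sub_distrib]
  refine Finset.sum_congr rfl fun i _ => Finset.sum_congr rfl fun j _ => ?_
  rw [hP3 i j, hP2 j i]
  field_simp
  ring

/-- The vector field whose divergence is the difference of the two integrands, split as a sum over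
`j` of its contributions to the `i`-th component. -/
noncomputable def yanoFlux (γ : ℝ) (w Φ : EuclideanSpace ℝ (Fin n) → ℝ) (i j : Fin n)
    (y : EuclideanSpace ℝ (Fin n)) : ℝ :=
  Real.exp ((2 * γ - 1) * w y) *
    (pder n j (pder n j Φ) y * pder n i Φ y - pder n i (pder n j Φ) y * pder n j Φ y
      + pder n j w y * pder n j Φ y * pder n i Φ y
      + (γ - 1) * (pder n i w y * (pder n j Φ y * pder n j Φ y)))

variable {w Φ : EuclideanSpace ℝ (Fin n) → ℝ}

theorem contDiff_yanoFlux (γ : ℝ) (hw : ContDiff ℝ (⊤ : ℕ∞) w) (hΦ : ContDiff ℝ (⊤ : ℕ∞) Φ)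
    (i j : Fin n) : ContDiff ℝ (⊤ : ℕ∞) (yanoFlux γ w Φ i j) := by
  have := hw.pder
  have := hΦ.pder
  have := hΦ.pder_pder
  unfold yanoFlux
  fun_prop

theorem hasCompactSupport_yanoFlux (γ : ℝ) (hc : HasCompactSupport Φ) (i j : Fin n) :
    HasCompactSupport (yanoFlux γ w Φ i j) :=
  HasCompactSupport.intro hc fun x hx => by
    simp [yanoFlux, pder_eq_zero_of_notMem_tsupport hx]

theorem pder_yanoFlux (γ : ℝ) (hw : ContDiff ℝ (⊤ : ℕ∞) w) (hΦ : ContDiff ℝ (⊤ : ℕ∞) Φ)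
    (i j : Fin n) (x : EuclideanSpace ℝ (Fin n)) :
    pder n i (yanoFlux γ w Φ i j) x = Real.exp ((2 * γ - 1) * w x) *
      ((2 * γ - 1) * pder n i w x *
          (pder n j (pder n j Φ) x * pder n i Φ x - pder n i (pder n j Φ) x * pder n j Φ x
            + pder n j w x * pder n j Φ x * pder n i Φ x
            + (γ - 1) * (pder n i w x * (pder n j Φ x * pder n j Φ x)))
        + (pder n i (pder n j (pder n j Φ)) x * pder n i Φ x
            + pder n j (pder n j Φ) x * pder n i (pder n i Φ) x
            - (pder n i (pder n i (pder n j Φ)) x * pder n j Φ x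
              + pder n i (pder n j Φ) x * pder n i (pder n j Φ) x)
          + ((pder n i (pder n j w) x * pder n j Φ x + pder n j w x * pder n i (pder n j Φ) x)
              * pder n i Φ x + pder n j w x * pder n j Φ x * pder n i (pder n i Φ) x)
          + (γ - 1) * (pder n i (pder n i w) x * (pder n j Φ x * pder n j Φ x)
              + pder n i w x * (pder n i (pder n j Φ) x * pder n j Φ x
                + pder n j Φ x * pder n i (pder n j Φ) x)))) := by
  have hw1 := hw.pder
  have hΦ1 := hΦ.pder
  have hΦ2 := hΦ.pder_pder
  change pder n i (fun y => yanoFlux γ w Φ i j y) x = _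
  unfold yanoFlux
  rw [pder_mul i (by fun_prop) (by fun_prop), pder_exp_const_mul i _ hw,
    pder_add i (by fun_prop) (by fun_prop), pder_add i (by fun_prop) (by fun_prop),
    pder_sub i (by fun_prop) (by fun_prop), pder_const_mul i _ (by fun_prop),
    pder_mul i (hΦ2 j j) (hΦ1 i), pder_mul i (hΦ2 i j) (hΦ1 j),
    pder_mul i ((hw1 j).mul (hΦ1 j)) (hΦ1 i), pder_mul i (hw1 j) (hΦ1 j),
    pder_mul i (hw1 i) ((hΦ1 j).mul (hΦ1 j)), pder_mul i (hΦ1 j) (hΦ1 j)]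
  ring

/-- The right-hand integrand of the generalized Yano formula for the weight `exp w`, expanded in
partial derivatives. -/
noncomputable def yanoDensity (γ : ℝ) (w Φ : EuclideanSpace ℝ (Fin n) → ℝ)
    (x : EuclideanSpace ℝ (Fin n)) : ℝ :=
  Real.exp ((2 * γ - 1) * w x) *
    (-(∑ i, ((γ - 1) ^ 2 * (pder n i w x * pder n i w x) + (γ - 1) * pder n i (pder n i w) x))
        * ∑ j, pder n j Φ x ^ 2
      - 1 / (γ - 1) * ∑ i, ∑ j, ((γ - 1) ^ 2 * (pder n i w x * pder n j w x)
          + (γ - 1) * pder n i (pder n j w) x) * pder n i Φ x * pder n j Φ x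
      + ∑ i, ∑ j, pder n i (pder n j Φ) x ^ 2
      + γ * (γ - 1) * ((∑ i, pder n i w x * pder n i Φ x) ^ 2
        - (∑ i, pder n i w x ^ 2) * ∑ j, pder n j Φ x ^ 2))

theorem integrable_yanoDensity (γ : ℝ) (hw : ContDiff ℝ (⊤ : ℕ∞) w)
    (hΦ : ContDiff ℝ (⊤ : ℕ∞) Φ) (hc : HasCompactSupport Φ) :
    Integrable (yanoDensity γ w Φ) := by
  have hw0 := hw.continuous
  have hw1 := fun i => (hw.pder i).continuous
  have hw2 := fun i j => (hw.pder_pder i j).continuous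
  have hΦ1 := fun i => (hΦ.pder i).continuous
  have hΦ2 := fun i j => (hΦ.pder_pder i j).continuous
  refine Continuous.integrable_of_hasCompactSupport ?_ (HasCompactSupport.intro hc fun x hx => ?_)
  · unfold yanoDensity
    fun_prop
  · simp [yanoDensity, pder_eq_zero_of_notMem_tsupport hx,
      pder_pder_eq_zero_of_notMem_tsupport hx]

theorem divg_exp_smul_gradient (c : ℝ) (hw : ContDiff ℝ (⊤ : ℕ∞) w)
    (hΦ : ContDiff ℝ (⊤ : ℕ∞) Φ) (x : EuclideanSpace ℝ (Fin n)) :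
    divg n (fun y => Real.exp (c * w y) • gradient Φ y) x =
      Real.exp (c * w x) *
        ∑ i, (pder n i (pder n i Φ) x + c * (pder n i w x * pder n i Φ x)) := by
  rw [divg, Finset.mul_sum]
  refine Finset.sum_congr rfl fun i _ => ?_
  simp only [PiLp.smul_apply, gradient_apply, smul_eq_mul]
  rw [pder_mul i (by fun_prop) (hΦ.pder i), pder_exp_const_mul i c hw]
  ring

theorem integral_exp_mul_sum_sq_eq (γ : ℝ) (hγ : γ ≠ 1) (hw : ContDiff ℝ (⊤ : ℕ∞) w)
    (hΦ : ContDiff ℝ (⊤ : ℕ∞) Φ) (hc : HasCompactSupport Φ) :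
    ∫ x, Real.exp ((2 * γ - 1) * w x) *
        (∑ i, (pder n i (pder n i Φ) x + γ * (pder n i w x * pder n i Φ x))) ^ 2 =
      ∫ x, yanoDensity γ w Φ x := by
  have hint : ∀ i j : Fin n, Integrable (pder n i (yanoFlux γ w Φ i j)) := fun i j =>
    integrable_pder (contDiff_yanoFlux γ hw hΦ i j) (hasCompactSupport_yanoFlux γ hc i j) i
  have hpt : ∀ x, Real.exp ((2 * γ - 1) * w x) *
        (∑ i, (pder n i (pder n i Φ) x + γ * (pder n i w x * pder n i Φ x))) ^ 2 =
      yanoDensity γ w Φ x + ∑ i, ∑ j, pder n i (yanoFlux γ w Φ i j) x := by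
    intro x
    simp only [pder_yanoFlux γ hw hΦ, ← Finset.mul_sum, yanoDensity]
    rw [← mul_add]
    congr 1
    exact bochner_sum_identity γ hγ (fun i => pder n i Φ x) (fun i => pder n i w x)
      (fun i j => pder n i (pder n j Φ) x) (fun i j => pder n i (pder n j w) x)
      (fun i j k => pder n i (pder n j (pder n k Φ)) x)
      (fun i j => by rw [pder_comm hΦ i j])
      (fun i j => by rw [pder_comm hΦ i j, pder_comm (hΦ.pder i) i j])
  simp only [hpt]
  rw [integral_add (integrable_yanoDensity γ hw hΦ hc)
      (integrable_finsetSum _ fun i _ => integrable_finsetSum _ fun j _ => hint i j),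
    integral_finsetSum _ fun i _ => integrable_finsetSum _ fun j _ => hint i j]
  simp only [integral_finsetSum _ fun j _ => hint _ j]
  simp [integral_pder_eq_zero (contDiff_yanoFlux γ hw hΦ _ _) (hasCompactSupport_yanoFlux γ hc _ _)]

end Yano

/-- generalized Yano formula (Theorem 2) on flat Euclidean space:
`∫ μ⁻¹ (∇·(μ^γ ∇Φ))² dx
  = ∫ μ^γ { −Δ(μ^{γ−1})‖∇Φ‖² − (1/(γ−1)) Hess(μ^{γ−1})(∇Φ,∇Φ)
            + μ^{γ−1}‖Hess Φ‖²
            + γ(γ−1) μ^{γ−1} (⟨∇log μ, ∇Φ⟩² − ‖∇log μ‖²‖∇Φ‖²) } dx`. -/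
theorem stmt7 (n : ℕ) (hn : 1 ≤ n) (γ : ℝ) (hγ : γ ≠ 1)
    (μ : EuclideanSpace ℝ (Fin n) → ℝ) (hμ : ContDiff ℝ (⊤ : ℕ∞) μ)
    (hμpos : ∀ x, 0 < μ x)
    (Φ : EuclideanSpace ℝ (Fin n) → ℝ) (hΦ : ContDiff ℝ (⊤ : ℕ∞) Φ)
    (hΦc : HasCompactSupport Φ) :
    ∫ x, (μ x)⁻¹ * (divg n (fun y => (μ y)^γ • gradient Φ y) x)^2
      = ∫ x, (μ x)^γ *
          (-(lapl n (fun y => (μ y)^(γ-1)) x) * ‖gradient Φ x‖^2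
            - (1/(γ-1)) * hessQF n (fun y => (μ y)^(γ-1)) x (gradient Φ x)
            + (μ x)^(γ-1) * hessFrob n Φ x
            + γ*(γ-1) * (μ x)^(γ-1) *
              (⟪gradient (fun y => Real.log (μ y)) x, gradient Φ x⟫_ℝ^2
                - ‖gradient (fun y => Real.log (μ y)) x‖^2 * ‖gradient Φ x‖^2)) := by
  obtain ⟨w, hw, rfl⟩ : ∃ w : EuclideanSpace ℝ (Fin n) → ℝ,
      ContDiff ℝ (⊤ : ℕ∞) w ∧ μ = fun x => Real.exp (w x) :=
    ⟨fun x => Real.log (μ x), hμ.log fun x => (hμpos x).ne',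
      funext fun x => (Real.exp_log (hμpos x)).symm⟩
  have hpow : ∀ c x, Real.exp (w x) ^ c = Real.exp (c * w x) := fun c x => by
    rw [← Real.exp_mul, mul_comm]
  simp only [hpow, Real.log_exp, divg_exp_smul_gradient γ hw hΦ]
  convert integral_exp_mul_sum_sq_eq γ hγ hw hΦ hΦc using 3 with x x
  · have hexp : Real.exp ((2 * γ - 1) * w x) = (Real.exp (w x))⁻¹ * Real.exp (γ * w x) ^ 2 := by
      rw [← Real.exp_neg, sq, ← Real.exp_add, ← Real.exp_add]
      ring_nf
    rw [hexp]
    ring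
  · have hexp : Real.exp ((2 * γ - 1) * w x) =
        Real.exp (γ * w x) * Real.exp ((γ - 1) * w x) := by
      rw [← Real.exp_add]
      ring_nf
    have hlapl : lapl n (fun y => Real.exp ((γ - 1) * w y)) x =
        ∑ i, hessij n (fun y => Real.exp ((γ - 1) * w y)) x i i := rfl
    simp only [hlapl, hessQF, hessFrob, hessij_exp_const_mul (γ - 1) hw, norm_gradient_sq,
      inner_gradient, gradient_apply, yanoDensity, hexp, mul_assoc, ← Finset.mul_sum]
    simp only [hessij]
    ring
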